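/- Let G and Q be groups with finitely generated abelianizations, let n be a natural number, and let l : ℤ^n → G and f : G → Q be group homomorphisms such that f is surjective, the image of l equals the kernel of f, and rank(G^{ab}) − rank(Q^{ab}) = n. Then the image of l is contained in the center of G. -/

import Mathlib

open TensorProduct

/-- The rank of the abelianization of a group `G`, i.e. `dim_ℚ (ℚ ⊗_ℤ G^{ab})`. -/
noncomputable def abRank (G : Type*) [Group G] : ℕ :=
  Module.finrank ℚ (ℚ ⊗[ℤ] Additive (Abelianization G))

/-- The rank of the abelianization equals its rank as a `ℤ`-module. -/
theorem abRank_eq_finrank (G : Type*) [Group G] :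
    abRank G = Module.finrank ℤ (Additive (Abelianization G)) :=
  (TensorProduct.isBaseChange ℤ (Additive (Abelianization G)) ℚ).finrank_eq

/-- A linear map from a free module of rank `n` is injective as soon as its range has
rank at least `n`. -/
theorem LinearMap.injective_of_finrank_le_finrank_range {R M N : Type*} [CommRing R] [IsDomain R]
    [IsNoetherianRing R] [AddCommGroup M] [Module R M] [Module.Free R M] [Module.Finite R M]
    [AddCommGroup N] [Module R N] (φ : M →ₗ[R] N)
    (h : Module.finrank R M ≤ Module.finrank R φ.range) : Function.Injective φ := by
  have h₁ := φ.ker.finrank_quotient_add_finrank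
  have h₂ := φ.quotKerEquivRange.finrank_eq
  have h₃ : Module.finrank R φ.ker = 0 := by omega
  rw [← LinearMap.ker_eq_bot, ← Submodule.finrank_eq_zero (R := R)]
  exact h₃

/-- For a surjection `f`, the kernel of the induced map on abelianizations is covered
by the kernel of `f`. -/
theorem Abelianization.exists_mem_ker_of_map_eq_one {G Q : Type*} [Group G] [Group Q]
    (f : G →* Q) (hf : Function.Surjective f) (x : Abelianization G)
    (hx : Abelianization.map f x = 1) : ∃ k ∈ f.ker, Abelianization.of k = x := by
  obtain ⟨g, rfl⟩ := QuotientGroup.mk_surjective x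
  change Abelianization.map f (Abelianization.of g) = 1 at hx
  rw [Abelianization.map_of, ← MonoidHom.mem_ker, Abelianization.ker_of, commutator_def,
    ← Subgroup.map_top_of_surjective f hf, ← Subgroup.map_commutator] at hx
  obtain ⟨c, hc, hcg⟩ := hx
  have hc' : Abelianization.of c = 1 := by
    rw [← MonoidHom.mem_ker, Abelianization.ker_of]
    exact hc
  refine ⟨g * c⁻¹, by simp [MonoidHom.mem_ker, hcg], ?_⟩
  rw [map_mul, map_inv, hc', inv_one, mul_one]
  rfl

open scoped commutatorElement in
/-- A normal subgroup meeting the commutator subgroup trivially is central. -/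
theorem Subgroup.Normal.le_center_of_disjoint_commutator {G : Type*} [Group G] {N : Subgroup G}
    (hN : N.Normal) (h : Disjoint N (_root_.commutator G)) : N ≤ Subgroup.center G := by
  intro x hx
  rw [Subgroup.mem_center_iff]
  intro g
  have h₁ : ⁅g, x⁆ ∈ N := N.mul_mem (hN.conj_mem x hx g) (N.inv_mem hx)
  have h₂ : ⁅g, x⁆ ∈ _root_.commutator G :=
    Subgroup.commutator_mem_commutator (Subgroup.mem_top g) (Subgroup.mem_top x)
  exact commutatorElement_eq_one_iff_mul_comm.mp (Subgroup.disjoint_def.mp h h₁ h₂)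

theorem torus_bundle_fiber_image_central
    {G Q : Type*} [Group G] [Group Q] (n : ℕ)
    [Group.FG (Abelianization G)] [Group.FG (Abelianization Q)]
    (l : Multiplicative (Fin n → ℤ) →* G) (f : G →* Q)
    (hf : Function.Surjective f) (hlf : l.range = f.ker)
    (hrank : (abRank G : ℤ) - (abRank Q : ℤ) = n) :
    l.range ≤ Subgroup.center G := by
  let φ : (Fin n → ℤ) →ₗ[ℤ] Additive (Abelianization G) :=
    (MonoidHom.toAdditiveRight (Abelianization.of.comp l)).toIntLinearMap
  let ψ : Additive (Abelianization G) →ₗ[ℤ] Additive (Abelianization Q) :=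
    (MonoidHom.toAdditive (Abelianization.map f)).toIntLinearMap
  have hfin : Module.Finite ℤ (Additive (Abelianization G)) :=
    Module.Finite.iff_addGroup_fg.mpr inferInstance
  have hfin' : Module.Finite ℤ (Additive (Abelianization Q)) :=
    Module.Finite.iff_addGroup_fg.mpr inferInstance
  have hker : ψ.ker ≤ φ.range := by
    intro x hx
    obtain ⟨k, hk, hkx⟩ := Abelianization.exists_mem_ker_of_map_eq_one f hf x.toMul hx
    rw [← hlf] at hk
    obtain ⟨v, rfl⟩ := hk
    exact ⟨v.toAdd, hkx⟩
  have hφ : Function.Injective φ := by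
    apply φ.injective_of_finrank_le_finrank_range
    have h₁ := ψ.ker.finrank_quotient_add_finrank
    have h₂ := ψ.quotKerEquivRange.finrank_eq
    have h₃ := ψ.range.finrank_le
    have h₄ := Submodule.finrank_mono hker
    rw [abRank_eq_finrank, abRank_eq_finrank] at hrank
    rw [Module.finrank_fin_fun]
    omega
  have hN : l.range.Normal := hlf ▸ f.normal_ker
  refine hN.le_center_of_disjoint_commutator (Subgroup.disjoint_def.mpr ?_)
  rintro _ ⟨v, rfl⟩ hv
  rw [← Abelianization.ker_of] at hv
  have hv₀ : v.toAdd = 0 := hφ ((show φ v.toAdd = 0 from hv).trans (map_zero φ).symm)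
  rw [show v = 1 from hv₀, map_one]
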